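/- arXiv:2108.13792 — 2 statements merged into one kernel-verified Lean document; each statement's English description precedes it below -/
import Mathlib

section
/- Let p ≥ 5 be a prime and set n := 2^(p−1). Then 2^p − 1 is prime if and only if there exists an integer m such that, in the rational numbers, ∑_{k even, 0 ≤ k ≤ n/2} (−1)^(k/2) · (∏_{λ=0}^{k/2 − 1} (n² − (4λ)²)) / k! = (2^p − 1) · m, where the sum ranges over even k and the product is empty (hence 1) when k = 0. -/
open Polynomial Chebyshev in
/-- Value of the derivatives of the Chebyshev polynomials at `1`, with denominators cleared to
central factorials. -/
theorem factorial_mul_iterate_derivative_T_eval_one {R : Type*} [CommRing R] (n : ℤ) (j : ℕ) :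
    ((2 * j).factorial : R) * (derivative^[j] (T R n)).eval 1 =
      2 ^ j * (j.factorial : R) * ∏ l ∈ Finset.range j, ((n : R) ^ 2 - (l : R) ^ 2) := by
  induction j with
  | zero => simp
  | succ j ih =>
    have hrec := iterate_derivative_T_eval_one_recurrence (R := R) n j
    rw [Finset.prod_range_succ, show 2 * (j + 1) = 2 * j + 1 + 1 by ring, Nat.factorial_succ,
      Nat.factorial_succ, Nat.factorial_succ]
    push_cast
    linear_combination (2 * (j : R) + 2) * ((2 * j).factorial : R) * hrec +
      (2 * (j : R) + 2) * ((n : R) ^ 2 - (j : R) ^ 2) * ih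

open Polynomial Chebyshev in
/-- Taylor expansion of the Chebyshev polynomials of the first kind at `1`. -/
theorem eval_T_add_one {K : Type*} [Field K] [CharZero K] (N : ℕ) (y : K) :
    (T K N).eval (y + 1) = ∑ j ∈ Finset.range (N + 1),
      (∏ l ∈ Finset.range j, ((N : K) ^ 2 - (l : K) ^ 2)) * (2 * y) ^ j /
        ((2 * j).factorial : K) := by
  rw [← taylor_eval, eval_eq_sum_range, natDegree_taylor, natDegree_T, Int.natAbs_natCast]
  refine Finset.sum_congr rfl fun j _ => ?_
  have hder : (j.factorial : K) * (hasseDeriv j (T K N)).eval 1 =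
      (derivative^[j] (T K N)).eval 1 := by
    rw [← factorial_smul_hasseDeriv]
    simp
  have hfac := factorial_mul_iterate_derivative_T_eval_one (R := K) N j
  have hj : (j.factorial : K) ≠ 0 := Nat.cast_ne_zero.mpr j.factorial_ne_zero
  have h2j : ((2 * j).factorial : K) ≠ 0 := Nat.cast_ne_zero.mpr (2 * j).factorial_ne_zero
  rw [taylor_coeff, eq_div_iff h2j]
  refine mul_left_cancel₀ hj ?_
  rw [← hder] at hfac
  push_cast at hfac
  rw [mul_pow]
  linear_combination y ^ j * hfac

open Polynomial Chebyshev in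
/-- The Lucas–Lehmer sequence as values of Chebyshev polynomials at `-7`. -/
theorem two_mul_eval_T_two_pow {K : Type*} [Field K] [CharZero K] (i : ℕ) :
    2 * (T K ((2 ^ (i + 1) : ℕ) : ℤ)).eval (-7) = (LucasLehmer.s (i + 2) : K) := by
  induction i with
  | zero => norm_num [LucasLehmer.s, T_two]
  | succ i ih =>
    rw [show ((2 ^ (i + 1 + 1) : ℕ) : ℤ) = 2 * ((2 ^ (i + 1) : ℕ) : ℤ) by push_cast; ring, T_mul,
      T_two, LucasLehmer.s]
    push_cast at ih ⊢
    rw [← ih]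
    simp
    ring

theorem LucasLehmer.even_s (i : ℕ) : Even (LucasLehmer.s i) := by
  induction i with
  | zero => exact ⟨2, rfl⟩
  | succ i ih => exact (ih.pow_of_ne_zero two_ne_zero).sub even_two

/-- The Lucas–Lehmer test as a divisibility statement between integers. -/
theorem mersenne_prime_iff_dvd_s (q : ℕ) :
    (2 ^ (q + 3) - 1).Prime ↔ (2 ^ (q + 3) - 1 : ℤ) ∣ LucasLehmer.s (q + 1) := by
  have htest : (2 ^ (q + 3) - 1).Prime ↔ LucasLehmer.LucasLehmerTest (q + 3) :=
    ⟨lucas_lehmer_necessity (q + 3) (by lia), lucas_lehmer_sufficiency (q + 3) (by lia)⟩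
  rw [htest, LucasLehmer.LucasLehmerTest, LucasLehmer.lucasLehmerResidue,
    LucasLehmer.sZMod_eq_s (q + 1), ZMod.intCast_zmod_eq_zero_iff_dvd]
  push_cast [Nat.one_le_two_pow]
  rfl

/-- Reindexing of a sum over the even numbers up to `2 * N`. -/
theorem sum_range_filter_even {M : Type*} [AddCommMonoid M] (N : ℕ) (f : ℕ → M) :
    ∑ k ∈ (Finset.range (2 * N + 1)).filter (fun k => k % 2 = 0), f k =
      ∑ j ∈ Finset.range (N + 1), f (2 * j) := by
  refine (Finset.sum_nbij' (2 * ·) (· / 2) ?_ ?_ ?_ ?_ fun _ _ => rfl).symm <;>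
    intro k hk <;> simp only [Finset.mem_filter, Finset.mem_range] at hk ⊢ <;> lia

open Polynomial Chebyshev in
/-- The explicit sum is a Chebyshev value at `-7`. -/
theorem explicit_sum_eq_eval_T (N : ℕ) :
    (∑ k ∈ (Finset.range (2 * N + 1)).filter (fun k => k % 2 = 0),
      (-1 : ℚ) ^ (k / 2) *
        (∏ l ∈ Finset.range (k / 2), (((4 * N : ℕ) : ℚ) ^ 2 - (4 * (l : ℚ)) ^ 2)) /
        (Nat.factorial k : ℚ)) = (T ℚ N).eval (-7) := by
  rw [sum_range_filter_even, show (-7 : ℚ) = -8 + 1 by norm_num, eval_T_add_one]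
  refine Finset.sum_congr rfl fun j _ => ?_
  rw [Nat.mul_div_cancel_left j two_pos]
  congr 1
  have hprod : ∏ l ∈ Finset.range j, (((4 * N : ℕ) : ℚ) ^ 2 - (4 * (l : ℚ)) ^ 2) =
      16 ^ j * ∏ l ∈ Finset.range j, ((N : ℚ) ^ 2 - (l : ℚ) ^ 2) := by
    rw [Finset.pow_eq_prod_const (16 : ℚ) j, ← Finset.prod_mul_distrib]
    refine Finset.prod_congr rfl fun l _ => ?_
    push_cast
    ring
  rw [hprod, ← mul_assoc, ← mul_pow, mul_comm]
  norm_num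

/-- Lucas–Lehmer–Moustafa primality test for Mersenne numbers, Version 2. -/
theorem mersenne_prime_iff_explicit_sum (p : ℕ) (hp : Nat.Prime p) (hp5 : 5 ≤ p)
    (n : ℕ) (hn : n = 2 ^ (p - 1)) :
    Nat.Prime (2 ^ p - 1) ↔
      ∃ m : ℤ,
        (∑ k ∈ (Finset.range (n / 2 + 1)).filter (fun k => k % 2 = 0),
          (-1 : ℚ) ^ (k / 2) *
            (∏ l ∈ Finset.range (k / 2), ((n : ℚ) ^ 2 - (4 * (l : ℚ)) ^ 2)) /
            (Nat.factorial k : ℚ)) = ((2 : ℚ) ^ p - 1) * (m : ℚ) := by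
  obtain ⟨i, rfl⟩ : ∃ i, p = i + 1 + 3 := ⟨p - 4, by lia⟩
  obtain rfl : n = 4 * 2 ^ (i + 1) := by
    rw [hn, show i + 1 + 3 - 1 = i + 1 + 2 by lia, pow_add, mul_comm]
    norm_num
  rw [show 4 * 2 ^ (i + 1) / 2 = 2 * 2 ^ (i + 1) by lia, explicit_sum_eq_eval_T,
    mersenne_prime_iff_dvd_s]
  have hs := two_mul_eval_T_two_pow (K := ℚ) i
  constructor
  · rintro ⟨c, hc⟩
    have hodd : ¬ Even (2 ^ (i + 1 + 3) - 1 : ℤ) := by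
      simp [Int.even_pow]
    obtain ⟨m, rfl⟩ : Even c :=
      (Int.even_mul.mp (hc ▸ LucasLehmer.even_s _)).resolve_left hodd
    refine ⟨m, ?_⟩
    rw [hc] at hs
    push_cast at hs ⊢
    linear_combination hs / 2
  · rintro ⟨m, hm⟩
    refine ⟨2 * m, ?_⟩
    rw [hm] at hs
    have hcast : (LucasLehmer.s (i + 2) : ℚ) =
        ((2 ^ (i + 1 + 3) - 1) * (2 * m) : ℤ) := by
      push_cast
      linear_combination -hs
    exact_mod_cast hcast
end

section
/- Let N be a natural number with N ≠ 6 and N ≠ 28. Then N is an even perfect number if and only if there exist a prime p ≥ 5 and an integer m such that N = 2^(p−1)·(2^p − 1) and, in the rational numbers, ∑_{k even, 0 ≤ k ≤ n/2} (−1)^(k/2) · (∏_{λ=0}^{k/2 − 1} (n² − (4λ)²)) / k! = (2^p − 1) · m, where n := 2^(p−1), the sum ranges over even k, and the product is empty (hence 1) when k = 0. -/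
open Polynomial in
theorem Polynomial.coeff_eq_iterate_derivative_eval_zero_div_factorial {K : Type*} [Field K]
    [CharZero K] (f : K[X]) (k : ℕ) :
    f.coeff k = (derivative^[k] f).eval 0 / (k.factorial : K) := by
  rw [← coeff_zero_eq_eval_zero, coeff_iterate_derivative, zero_add, Nat.descFactorial_self,
    nsmul_eq_mul, mul_div_cancel_left₀ _ (Nat.cast_ne_zero.2 k.factorial_ne_zero)]

namespace Polynomial.Chebyshev

theorem iterate_derivative_T_eval_zero_two_mul {R : Type*} [CommRing R] (n : ℤ) (j : ℕ) :
    (derivative^[2 * j] (T R n)).eval 0 =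
      (-1) ^ j * (∏ l ∈ Finset.range j, ((n : R) ^ 2 - (2 * (l : R)) ^ 2)) * (T R n).eval 0 := by
  induction j with
  | zero => simp
  | succ j ih =>
    rw [show 2 * (j + 1) = 2 * j + 2 by ring, iterate_derivative_T_eval_zero_recurrence, ih,
      Finset.prod_range_succ]
    push_cast
    ring

theorem iterate_derivative_T_eval_zero_two_mul_add_one {R : Type*} [CommRing R] {n : ℤ}
    (hn : Even n) (j : ℕ) : (derivative^[2 * j + 1] (T R n)).eval 0 = 0 := by
  induction j with
  | zero => simp [T_derivative_eq_U, U_eval_zero_of_odd R (hn.sub_odd odd_one)]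
  | succ j ih =>
    rw [show 2 * (j + 1) + 1 = 2 * j + 1 + 2 by ring, iterate_derivative_T_eval_zero_recurrence,
      ih, mul_zero]

/-- The Taylor expansion at `0` of `T n`, evaluated at `2`, for `n` divisible by `4`. -/
theorem T_eval_two_eq_sum {K : Type*} [Field K] [CharZero K] {n : ℕ} (hn : 4 ∣ n) :
    (T K n).eval 2 = ∑ k ∈ (Finset.range (n + 1)).filter (fun k => k % 2 = 0),
      (-1 : K) ^ (k / 2) *
        (∏ l ∈ Finset.range (k / 2), ((2 * n : K) ^ 2 - (4 * (l : K)) ^ 2)) /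
        (Nat.factorial k : K) := by
  have hn2 : Even (n : ℤ) := by
    rw [Int.even_coe_nat]
    exact even_iff_two_dvd.2 (dvd_trans (by norm_num) hn)
  have h0 : (T K n).eval 0 = 1 := by
    obtain ⟨m, rfl⟩ := hn
    rw [T_eval_zero_of_even _ hn2, show ((4 * m : ℕ) : ℤ) / 2 = m + m by push_cast; omega,
      Int.negOnePow_even _ ⟨_, rfl⟩]
    simp
  rw [eval_eq_sum_range, natDegree_T, Int.natAbs_natCast, Finset.sum_filter]
  refine Finset.sum_congr rfl fun k _ => ?_
  rw [coeff_eq_iterate_derivative_eval_zero_div_factorial]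
  obtain ⟨j, rfl | rfl⟩ := k.even_or_odd'
  · have hprod : ∏ l ∈ Finset.range j, ((2 * n : K) ^ 2 - (4 * (l : K)) ^ 2) =
        2 ^ (2 * j) * ∏ l ∈ Finset.range j, ((n : K) ^ 2 - (2 * (l : K)) ^ 2) := by
      rw [pow_mul, ← Finset.card_range j, ← Finset.prod_const, Finset.card_range,
        ← Finset.prod_mul_distrib]
      exact Finset.prod_congr rfl fun l _ => by ring
    rw [if_pos (by omega), Nat.mul_div_cancel_left _ two_pos, hprod,
      iterate_derivative_T_eval_zero_two_mul, h0]
    push_cast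
    ring
  · rw [if_neg (by omega), iterate_derivative_T_eval_zero_two_mul_add_one hn2]
    simp

end Polynomial.Chebyshev

namespace LucasLehmer

open Polynomial

theorem s_eq_two_mul_T_eval_two (i : ℕ) :
    s i = 2 * (Chebyshev.T ℤ ((2 ^ i : ℕ) : ℤ)).eval 2 := by
  induction i with
  | zero => simp [s]
  | succ i ih =>
    rw [s, ih, pow_succ' 2 i, Nat.cast_mul, Chebyshev.T_mul]
    simp [Chebyshev.T_two]
    ring

theorem lucasLehmerTest_iff_dvd_s {p : ℕ} (hp : 2 ≤ p) :
    LucasLehmerTest p ↔ (2 ^ p - 1 : ℤ) ∣ s (p - 2) := by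
  obtain ⟨q, rfl⟩ := Nat.exists_eq_add_of_le' hp
  rw [LucasLehmerTest, lucasLehmerResidue, sZMod_eq_s, ZMod.intCast_zmod_eq_zero_iff_dvd]
  simp

theorem mersenne_prime_iff_dvd_T_eval_two {p : ℕ} (hp : 3 ≤ p) :
    (mersenne p).Prime ↔
      (2 ^ p - 1 : ℤ) ∣ (Chebyshev.T ℤ ((2 ^ (p - 2) : ℕ) : ℤ)).eval 2 := by
  have hcop : IsCoprime (2 ^ p - 1 : ℤ) 2 := by
    refine ⟨-1, 2 ^ (p - 1), ?_⟩
    rw [← pow_succ, show p - 1 + 1 = p by omega]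
    ring
  have hdvd : (2 ^ p - 1 : ℤ) ∣ (Chebyshev.T ℤ ((2 ^ (p - 2) : ℕ) : ℤ)).eval 2 ↔
      (2 ^ p - 1 : ℤ) ∣ 2 * (Chebyshev.T ℤ ((2 ^ (p - 2) : ℕ) : ℤ)).eval 2 :=
    ⟨fun h => h.mul_left 2, hcop.dvd_of_dvd_mul_left⟩
  rw [hdvd, ← s_eq_two_mul_T_eval_two, ← lucasLehmerTest_iff_dvd_s (by omega)]
  exact ⟨lucas_lehmer_necessity p hp, lucas_lehmer_sufficiency p (by omega)⟩

end LucasLehmer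

namespace Nat

theorem sum_divisors_two_pow_mul {k m : ℕ} (hm : Odd m) :
    ∑ d ∈ (2 ^ k * m).divisors, d = mersenne (k + 1) * ∑ d ∈ m.divisors, d := by
  rw [(Nat.coprime_two_left.2 hm).pow_left k |>.sum_divisors_mul,
    Nat.divisors_prime_pow Nat.prime_two]
  simp [mersenne, Nat.geomSum_eq le_rfl]

/-- **Euclid's theorem** on perfect numbers. -/
theorem perfect_two_pow_mul_mersenne {k : ℕ} (hk : (mersenne (k + 1)).Prime) :
    Perfect (2 ^ k * mersenne (k + 1)) := by
  rw [perfect_iff_sum_divisors_eq_two_mul (by have := hk.pos; positivity),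
    sum_divisors_two_pow_mul (by simp), hk.sum_divisors, succ_mersenne]
  ring

/-- **Euler's theorem** on even perfect numbers. -/
theorem Perfect.exists_eq_two_pow_mul_mersenne {N : ℕ} (hN : Perfect N) (heven : Even N) :
    ∃ k, (mersenne (k + 1)).Prime ∧ N = 2 ^ k * mersenne (k + 1) := by
  have hpos := hN.2
  obtain ⟨k, m, hm, rfl⟩ := exists_eq_two_pow_mul_odd hpos.ne'
  have hk : k ≠ 0 := by
    rintro rfl
    exact Nat.not_even_iff_odd.2 hm (by simpa using heven)
  rw [perfect_iff_sum_divisors_eq_two_mul hpos, sum_divisors_two_pow_mul hm, ← mul_assoc,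
    ← pow_succ'] at hN
  have hcop : (mersenne (k + 1)).Coprime (2 ^ (k + 1)) :=
    (Nat.coprime_two_right.2 (by simp)).pow_right _
  obtain ⟨j, rfl⟩ := hcop.dvd_of_dvd_mul_left (Dvd.intro _ hN)
  have hmer : 1 < mersenne (k + 1) := one_lt_mersenne.2 (by omega)
  have hsum : ∑ d ∈ (mersenne (k + 1) * j).properDivisors, d = j := by
    rw [sum_divisors_eq_sum_properDivisors_add_self, ← succ_mersenne] at hN
    have := Nat.eq_of_mul_eq_mul_left (by omega) (hN.trans (mul_left_comm _ _ _))
    linarith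
  have hj : 0 < j := Nat.pos_of_ne_zero (by rintro rfl; simp at hpos)
  rcases sum_properDivisors_dvd (by rw [hsum]; exact Dvd.intro_left _ rfl) with h | h
  · rw [hsum] at h
    subst h
    rw [mul_one] at hsum ⊢
    exact ⟨k, sum_properDivisors_eq_one_iff_prime.1 hsum, rfl⟩
  · rw [hsum] at h
    nlinarith

end Nat

/-- Euclid–Euler–Lucas–Lehmer–Moustafa characterization of even perfect numbers. -/
theorem even_perfect_iff_explicit_sum (N : ℕ) (h6 : N ≠ 6) (h28 : N ≠ 28) :
    (Nat.Perfect N ∧ Even N) ↔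
      ∃ p : ℕ, Nat.Prime p ∧ 5 ≤ p ∧ N = 2 ^ (p - 1) * (2 ^ p - 1) ∧
        ∃ m : ℤ,
          (∑ k ∈ (Finset.range (2 ^ (p - 1) / 2 + 1)).filter (fun k => k % 2 = 0),
            (-1 : ℚ) ^ (k / 2) *
              (∏ l ∈ Finset.range (k / 2), (((2 ^ (p - 1) : ℕ) : ℚ) ^ 2 - (4 * (l : ℚ)) ^ 2)) /
              (Nat.factorial k : ℚ)) = ((2 : ℚ) ^ p - 1) * (m : ℚ) := by
  have key : ∀ p : ℕ, 5 ≤ p → ((mersenne p).Prime ↔ ∃ m : ℤ,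
      (∑ k ∈ (Finset.range (2 ^ (p - 1) / 2 + 1)).filter (fun k => k % 2 = 0),
        (-1 : ℚ) ^ (k / 2) *
          (∏ l ∈ Finset.range (k / 2), (((2 ^ (p - 1) : ℕ) : ℚ) ^ 2 - (4 * (l : ℚ)) ^ 2)) /
          (Nat.factorial k : ℚ)) = ((2 : ℚ) ^ p - 1) * (m : ℚ)) := by
    intro p hp
    have hpow : 2 ^ (p - 1) = 2 * 2 ^ (p - 2) := by
      rw [← pow_succ', show p - 2 + 1 = p - 1 by omega]
    have hcast := Polynomial.Chebyshev.algebraMap_eval_T (R' := ℚ) (2 : ℤ) ((2 ^ (p - 2) : ℕ) : ℤ)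
    rw [map_ofNat, Polynomial.Chebyshev.T_eval_two_eq_sum
      (pow_dvd_pow 2 (show 2 ≤ p - 2 by omega))] at hcast
    rw [LucasLehmer.mersenne_prime_iff_dvd_T_eval_two (by omega), hpow,
      Nat.mul_div_cancel_left _ two_pos, Nat.cast_mul, Nat.cast_ofNat, ← hcast]
    refine exists_congr fun m => ?_
    rw [eq_intCast]
    exact_mod_cast Iff.rfl
  constructor
  · rintro ⟨hN, heven⟩
    obtain ⟨k, hk, rfl⟩ := hN.exists_eq_two_pow_mul_mersenne heven
    have hprime := hk.of_mersenne
    have h5 : 5 ≤ k + 1 := by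
      by_contra! hlt
      have : k ≤ 3 := by omega
      interval_cases k <;> revert hprime h6 h28 <;> norm_num [mersenne]
    exact ⟨k + 1, hprime, h5, rfl, (key _ h5).1 hk⟩
  · rintro ⟨p, -, h5, rfl, hsum⟩
    obtain ⟨k, rfl⟩ : ∃ k, p = k + 1 := ⟨p - 1, by omega⟩
    refine ⟨Nat.perfect_two_pow_mul_mersenne ((key _ h5).2 hsum), ?_⟩
    exact ((Nat.even_pow.2 ⟨even_two, by omega⟩ : Even (2 ^ k))).mul_right _
end
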